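/- For all x ∈ ℝ² with ‖x‖ ≥ R̃ one has |ψ(x)| ≤ ‖ψ‖_∞ · e^{−κ(‖x‖ − R̃)}, where ‖ψ‖_∞ := sup_{z ∈ ℝ²} |ψ(z)|. (Exponential decay of eigenfunctions, Lemma 5.5 of the paper; here stated with the comparison function e^{−κ(|x|−R̃)}.) -/

import Mathlib

open Set Filter

/-- The Laplacian of `ψ : ℝ² → ℝ` at `x`: the sum of the two repeated second partial
derivatives (the trace of the second derivative). -/
noncomputable def planeLaplacian (ψ : EuclideanSpace ℝ (Fin 2) → ℝ)
    (x : EuclideanSpace ℝ (Fin 2)) : ℝ :=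
  ∑ i : Fin 2,
    fderiv ℝ (fun z => fderiv ℝ ψ z (EuclideanSpace.single i (1:ℝ))) x
      (EuclideanSpace.single i (1:ℝ))

theorem IsLocalMax.deriv_deriv_nonpos {g : ℝ → ℝ} {a : ℝ} (h : IsLocalMax g a)
    (hg : ContinuousAt g a) : deriv (deriv g) a ≤ 0 := by
  by_contra! hpos
  have hmin : IsLocalMin g a := isLocalMin_of_deriv_deriv_pos hpos h.deriv_eq_zero hg
  have hconst : g =ᶠ[nhds a] fun _ => g a := by
    filter_upwards [h, hmin] with t h₁ h₂ using le_antisymm h₁ h₂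
  have hzero : deriv (deriv g) a = 0 := by
    rw [hconst.deriv.deriv_eq]
    simp
  exact hpos.ne' hzero

/-- If `t ↦ ψ (x + t e) - c exp (b t)` has a local maximum at `0`, then the second derivative of
`ψ` at `x` in the direction `e` is at most `c b²`. -/
theorem fderiv_fderiv_le_of_isLocalMax_sub_exp {E : Type*} [NormedAddCommGroup E]
    [NormedSpace ℝ E] {ψ : E → ℝ} {x e : E} {b c : ℝ} (hψ : ContDiffAt ℝ 2 ψ x)
    (hmax : IsLocalMax (fun t : ℝ => ψ (x + t • e) - c * Real.exp (b * t)) 0) :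
    fderiv ℝ (fun z => fderiv ℝ ψ z e) x e ≤ c * b ^ 2 := by
  have hline : ∀ t : ℝ, HasDerivAt (fun t : ℝ => x + t • e) e t := fun t => by
    simpa using ((hasDerivAt_id t).smul_const e).const_add x
  have hexp : ∀ t : ℝ, HasDerivAt (fun t : ℝ => Real.exp (b * t)) (Real.exp (b * t) * b) t :=
    fun t => by simpa using ((hasDerivAt_id t).const_mul b).exp
  have hnear : ∀ᶠ t : ℝ in nhds 0, ContDiffAt ℝ 2 ψ (x + t • e) := by
    have htend : Tendsto (fun t : ℝ => x + t • e) (nhds 0) (nhds x) := by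
      simpa using (hline 0).continuousAt.tendsto
    exact htend.eventually (hψ.eventually (by simp))
  have hfirst : ∀ᶠ t : ℝ in nhds 0,
      HasDerivAt (fun t : ℝ => ψ (x + t • e) - c * Real.exp (b * t))
        (fderiv ℝ ψ (x + t • e) e - c * (Real.exp (b * t) * b)) t := by
    filter_upwards [hnear] with t ht
    exact ((ht.differentiableAt (by simp)).hasFDerivAt.comp_hasDerivAt t (hline t)).sub
      ((hexp t).const_mul c)
  have hdiff : DifferentiableAt ℝ (fun z => fderiv ℝ ψ z e) (x + (0 : ℝ) • e) := by
    have hd : DifferentiableAt ℝ (fderiv ℝ ψ) x :=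
      (hψ.fderiv_right (m := 1) (by norm_num)).differentiableAt (by simp)
    simpa using hd.clm_apply (differentiableAt_const e)
  have hsecond : HasDerivAt
      (fun t : ℝ => fderiv ℝ ψ (x + t • e) e - c * (Real.exp (b * t) * b))
      (fderiv ℝ (fun z => fderiv ℝ ψ z e) (x + (0 : ℝ) • e) e
        - c * (Real.exp (b * 0) * b * b)) 0 := by
    have hcomp := hdiff.hasFDerivAt.comp_hasDerivAt (0 : ℝ) (hline 0)
    exact hcomp.fun_sub (((hexp 0).mul_const b).const_mul c)
  have hle := hmax.deriv_deriv_nonpos hfirst.self_of_nhds.continuousAt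
  have hderiv : deriv (fun t : ℝ => ψ (x + t • e) - c * Real.exp (b * t)) =ᶠ[nhds 0]
      fun t : ℝ => fderiv ℝ ψ (x + t • e) e - c * (Real.exp (b * t) * b) :=
    hfirst.mono fun t ht => ht.deriv
  rw [hderiv.deriv_eq, hsecond.deriv] at hle
  simp only [zero_smul, add_zero, mul_zero, Real.exp_zero, one_mul] at hle
  linarith

/-- A plane wave `exp (-κ ⟪·, x⟫ / ‖x‖)` dominates `exp (-κ ‖·‖)` and touches it at `x`, so at a
local maximum `x` of `ψ - M exp (-κ (‖·‖ - R))` the Laplacian of `ψ` is at most the one of the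
plane wave. -/
theorem planeLaplacian_le_of_isLocalMax_sub_exp {ψ : EuclideanSpace ℝ (Fin 2) → ℝ} {κ R M : ℝ}
    {x : EuclideanSpace ℝ (Fin 2)} (hκ : 0 ≤ κ) (hM : 0 ≤ M) (hx : x ≠ 0)
    (hψ : ContDiffAt ℝ 2 ψ x)
    (hmax : IsLocalMax (fun z => ψ z - M * Real.exp (-κ * (‖z‖ - R))) x) :
    planeLaplacian ψ x ≤ κ ^ 2 * (M * Real.exp (-κ * (‖x‖ - R))) := by
  have hr : 0 < ‖x‖ := norm_pos_iff.mpr hx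
  have hpartial : ∀ i : Fin 2,
      fderiv ℝ (fun z => fderiv ℝ ψ z (EuclideanSpace.single i (1 : ℝ))) x
        (EuclideanSpace.single i (1 : ℝ))
      ≤ M * Real.exp (-κ * (‖x‖ - R)) * (-κ * (x i / ‖x‖)) ^ 2 := by
    intro i
    apply fderiv_fderiv_le_of_isLocalMax_sub_exp hψ
    have htend : Tendsto (fun t : ℝ => x + t • EuclideanSpace.single i (1 : ℝ))
        (nhds 0) (nhds x) := by
      have hcont : Continuous fun t : ℝ => x + t • EuclideanSpace.single i (1 : ℝ) := by
        fun_prop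
      simpa using hcont.tendsto 0
    filter_upwards [htend.eventually hmax] with t ht
    have hnorm : ‖x‖ + x i / ‖x‖ * t ≤ ‖x + t • EuclideanSpace.single i (1 : ℝ)‖ := by
      have hcs := real_inner_le_norm x (x + t • EuclideanSpace.single i (1 : ℝ))
      rw [inner_add_right, real_inner_self_eq_norm_sq, inner_smul_right,
        EuclideanSpace.inner_single_right] at hcs
      simp only [one_mul, conj_trivial] at hcs
      have heq : ‖x‖ * (‖x‖ + x i / ‖x‖ * t) = ‖x‖ ^ 2 + t * x i := by
        field_simp
      exact le_of_mul_le_mul_left (heq ▸ hcs) hr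
    have hexp : M * Real.exp (-κ * (‖x + t • EuclideanSpace.single i (1 : ℝ)‖ - R)) ≤
        M * Real.exp (-κ * (‖x‖ - R)) * Real.exp (-κ * (x i / ‖x‖) * t) := by
      rw [mul_assoc, ← Real.exp_add]
      gcongr
      nlinarith [mul_le_mul_of_nonneg_left hnorm hκ]
    simp only [zero_smul, add_zero, mul_zero, Real.exp_zero, mul_one]
    linarith
  have hunit : (x 0 / ‖x‖) ^ 2 + (x 1 / ‖x‖) ^ 2 = 1 := by
    have hsq := EuclideanSpace.real_norm_sq_eq x
    rw [Fin.sum_univ_two] at hsq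
    rw [div_pow, div_pow, ← add_div, ← hsq, div_self (by positivity)]
  calc planeLaplacian ψ x
      ≤ ∑ i : Fin 2, M * Real.exp (-κ * (‖x‖ - R)) * (-κ * (x i / ‖x‖)) ^ 2 :=
        Finset.sum_le_sum fun i _ => hpartial i
    _ = κ ^ 2 * (M * Real.exp (-κ * (‖x‖ - R))) *
          ((x 0 / ‖x‖) ^ 2 + (x 1 / ‖x‖) ^ 2) := by
        rw [Fin.sum_univ_two]
        ring
    _ = κ ^ 2 * (M * Real.exp (-κ * (‖x‖ - R))) := by rw [hunit, mul_one]

theorem planeLaplacian_neg (ψ : EuclideanSpace ℝ (Fin 2) → ℝ) (x : EuclideanSpace ℝ (Fin 2)) :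
    planeLaplacian (fun z => -ψ z) x = -planeLaplacian ψ x := by
  simp [planeLaplacian, fderiv_fun_neg, add_comm]

theorem le_mul_exp_of_planeLaplacian_eq {R κ M : ℝ} (hR : 0 ≤ R) (hκ : 0 < κ) (hM : 0 ≤ M)
    {ψ : EuclideanSpace ℝ (Fin 2) → ℝ} (hcont : Continuous ψ) (hle : ∀ z, ψ z ≤ M)
    (hzero : Tendsto ψ (cocompact (EuclideanSpace ℝ (Fin 2))) (nhds 0))
    (hC2 : ContDiffOn ℝ 2 ψ {x | R < ‖x‖})
    (heq : ∀ x : EuclideanSpace ℝ (Fin 2), R < ‖x‖ → planeLaplacian ψ x = κ ^ 2 * ψ x)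
    {x : EuclideanSpace ℝ (Fin 2)} (hx : R ≤ ‖x‖) :
    ψ x ≤ M * Real.exp (-κ * (‖x‖ - R)) := by
  by_contra! hlt
  set u : EuclideanSpace ℝ (Fin 2) → ℝ := fun z => ψ z - M * Real.exp (-κ * (‖z‖ - R)) with hu
  have hux : 0 < u x := sub_pos.mpr hlt
  have hclosed : IsClosed {z : EuclideanSpace ℝ (Fin 2) | R ≤ ‖z‖} :=
    isClosed_le continuous_const continuous_norm
  have hinfty : ∀ᶠ z in cocompact (EuclideanSpace ℝ (Fin 2)) ⊓ principal {z | R ≤ ‖z‖}, u z ≤ u x := by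
    filter_upwards [(hzero.eventually (gt_mem_nhds hux)).filter_mono inf_le_left] with z hz
    have : 0 ≤ M * Real.exp (-κ * (‖z‖ - R)) := by positivity
    simp only [hu] at hz ⊢
    linarith
  obtain ⟨y, hy, hymax⟩ :=
    (show Continuous u by fun_prop).continuousOn.exists_isMaxOn' hclosed hx hinfty
  have huy : 0 < u y := hux.trans_le (hymax hx)
  have hRy : R < ‖y‖ := by
    refine lt_of_le_of_ne hy fun h => ?_
    have := hle y
    simp only [hu, ← h, sub_self, mul_zero, Real.exp_zero, mul_one] at huy
    linarith
  have hnhds : {z : EuclideanSpace ℝ (Fin 2) | R < ‖z‖} ∈ nhds y :=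
    (isOpen_lt continuous_const continuous_norm).mem_nhds hRy
  have hlap := planeLaplacian_le_of_isLocalMax_sub_exp hκ.le hM
    (norm_pos_iff.mp (hR.trans_lt hRy)) (hC2.contDiffAt hnhds)
    (hymax.isLocalMax (mem_of_superset hnhds fun z (hz : R < ‖z‖) => hz.le))
  rw [heq y hRy] at hlap
  have := le_of_mul_le_mul_left hlap (by positivity)
  simp only [hu] at huy
  linarith

/-- Lemma 5.5 of the paper (exponential decay of eigenfunctions): for `‖x‖ ≥ R̃`,
`|ψ(x)| ≤ ‖ψ‖_∞ · e^{−κ(‖x‖−R̃)}`. -/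
theorem eigenfunction_exponential_decay
    (R' κ : ℝ) (hR' : 0 < R') (hκ : 0 < κ)
    (ψ : EuclideanSpace ℝ (Fin 2) → ℝ)
    (hψcont : Continuous ψ)
    (hbdd : BddAbove (Set.range fun z => |ψ z|))
    (hψ0 : Tendsto ψ (cocompact (EuclideanSpace ℝ (Fin 2))) (nhds 0))
    (hψC2 : ContDiffOn ℝ 2 ψ {x | R' < ‖x‖})
    (heq : ∀ x : EuclideanSpace ℝ (Fin 2), R' < ‖x‖ → planeLaplacian ψ x = κ ^ 2 * ψ x) :
    ∀ x : EuclideanSpace ℝ (Fin 2), R' ≤ ‖x‖ →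
      |ψ x| ≤ (⨆ z, |ψ z|) * Real.exp (-κ * (‖x‖ - R')) := by
  have hsup : ∀ z, |ψ z| ≤ ⨆ z, |ψ z| := fun z => le_ciSup hbdd z
  have hM : 0 ≤ ⨆ z, |ψ z| := (abs_nonneg _).trans (hsup 0)
  intro x hx
  refine abs_le'.mpr ⟨?_, ?_⟩
  · exact le_mul_exp_of_planeLaplacian_eq hR'.le hκ hM hψcont
      (fun z => (le_abs_self _).trans (hsup z)) hψ0 hψC2 heq hx
  · refine le_mul_exp_of_planeLaplacian_eq (ψ := fun z => -ψ z) hR'.le hκ hM hψcont.neg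
      (fun z => (neg_le_abs _).trans (hsup z)) (by simpa using hψ0.neg) hψC2.neg
      (fun z hz => ?_) hx
    rw [planeLaplacian_neg, heq z hz, mul_neg]
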